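/- arXiv:1612.02573 — 11 statements merged into one kernel-verified Lean document; each statement's English description precedes it below -/
import Mathlib

section
/- For any three unit vectors x, z, r in ℂ^d, setting a = |⟨r, x⟩|², b = |⟨r, z⟩|², and c = |⟨x, z⟩|², one has a + b ≤ 1 + √c. -/
open scoped InnerProductSpace

/-- For three unit vectors `x, z, r` in `ℂ^d`, with `a = |⟨r,x⟩|²`, `b = |⟨r,z⟩|²`,
`c = |⟨x,z⟩|²`, one has `a + b ≤ 1 + √c`. -/
theorem stmt1 {d : ℕ} (x z r : EuclideanSpace ℂ (Fin d))
    (hx : ‖x‖ = 1) (hz : ‖z‖ = 1) (hr : ‖r‖ = 1) :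
    ‖⟪r, x⟫_ℂ‖ ^ 2 + ‖⟪r, z⟫_ℂ‖ ^ 2 ≤ 1 + Real.sqrt (‖⟪x, z⟫_ℂ‖ ^ 2) := by
  rw [Real.sqrt_sq (norm_nonneg _)]
  set α := ⟪x, r⟫_ℂ with hα
  set β := ⟪z, r⟫_ℂ with hβ
  have h1 : ‖⟪r, x⟫_ℂ‖ = ‖α‖ := norm_inner_symm r x
  have h2 : ‖⟪r, z⟫_ℂ‖ = ‖β‖ := norm_inner_symm r z
  rw [h1, h2]
  have hS : ⟪α • x + β • z, r⟫_ℂ = ((‖α‖ ^ 2 + ‖β‖ ^ 2 : ℝ) : ℂ) := by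
    rw [inner_add_left, inner_smul_left, inner_smul_left, ← hα, ← hβ,
      Complex.conj_mul', Complex.conj_mul']
    push_cast
    rfl
  have hle : ‖α‖ ^ 2 + ‖β‖ ^ 2 ≤ ‖α • x + β • z‖ := by
    have h := norm_inner_le_norm (𝕜 := ℂ) (α • x + β • z) r
    rw [hS, hr, mul_one, Complex.norm_real, Real.norm_of_nonneg (by positivity)] at h
    exact h
  have hv : ‖α • x + β • z‖ ^ 2 ≤ ‖α‖ ^ 2 + ‖β‖ ^ 2 + 2 * (‖α‖ * ‖β‖ * ‖⟪x, z⟫_ℂ‖) := by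
    have h := norm_add_sq (𝕜 := ℂ) (α • x) (β • z)
    have h3 := RCLike.re_le_norm (⟪α • x, β • z⟫_ℂ)
    have h4 : ‖⟪α • x, β • z⟫_ℂ‖ = ‖α‖ * ‖β‖ * ‖⟪x, z⟫_ℂ‖ := by
      rw [inner_smul_left, inner_smul_right, norm_mul, norm_mul, RCLike.norm_conj, mul_assoc]
    rw [norm_smul, norm_smul, hx, hz, mul_one, mul_one] at h
    rw [h4] at h3
    linarith
  have ht : 0 ≤ ‖⟪x, z⟫_ℂ‖ := norm_nonneg _
  generalize ‖⟪x, z⟫_ℂ‖ = t at *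
  have hab : 2 * (‖α‖ * ‖β‖ * t) ≤ (‖α‖ ^ 2 + ‖β‖ ^ 2) * t := by
    nlinarith [mul_nonneg ht (sq_nonneg (‖α‖ - ‖β‖))]
  have hS0 : 0 ≤ ‖α‖ ^ 2 + ‖β‖ ^ 2 := by positivity
  generalize ‖α‖ ^ 2 + ‖β‖ ^ 2 = S at *
  have hsq : S ^ 2 ≤ ‖α • x + β • z‖ ^ 2 := pow_le_pow_left₀ hS0 hle 2
  by_contra hcon
  push Not at hcon
  nlinarith
end

section
/- For any three unit vectors x, z, r in ℂ^d, setting a = |⟨r, x⟩|², b = |⟨r, z⟩|², and c = |⟨x, z⟩|², one has |a − b| ≤ √(1 − c). -/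
open scoped InnerProductSpace

/-- For three unit vectors `x, z, r` in `ℂ^d`, with `a = |⟨r,x⟩|²`, `b = |⟨r,z⟩|²`,
`c = |⟨x,z⟩|²`, one has `|a - b| ≤ √(1 - c)`. -/
theorem stmt2 {d : ℕ} (x z r : EuclideanSpace ℂ (Fin d))
    (hx : ‖x‖ = 1) (hz : ‖z‖ = 1) (hr : ‖r‖ = 1) :
    |‖⟪r, x⟫_ℂ‖ ^ 2 - ‖⟪r, z⟫_ℂ‖ ^ 2| ≤ Real.sqrt (1 - ‖⟪x, z⟫_ℂ‖ ^ 2) := by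
  have hxx : ⟪x, x⟫_ℂ = 1 := by rw [inner_self_eq_norm_sq_to_K, hx]; simp
  have hzz : ⟪z, z⟫_ℂ = 1 := by rw [inner_self_eq_norm_sq_to_K, hz]; simp
  have hrr : ⟪r, r⟫_ℂ = 1 := by rw [inner_self_eq_norm_sq_to_K, hr]; simp
  have hxr : ⟪x, r⟫_ℂ = starRingEnd ℂ ⟪r, x⟫_ℂ := (inner_conj_symm _ _).symm
  have hzr : ⟪z, r⟫_ℂ = starRingEnd ℂ ⟪r, z⟫_ℂ := (inner_conj_symm _ _).symm
  have hzx : ⟪z, x⟫_ℂ = starRingEnd ℂ ⟪x, z⟫_ℂ := (inner_conj_symm _ _).symm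
  have h1 := inner_mul_inner_self_le (𝕜 := ℂ) (x - ⟪r, x⟫_ℂ • r) (z - ⟪r, z⟫_ℂ • r)
  have h2 := inner_mul_inner_self_le (𝕜 := ℂ) r (⟪x, r⟫_ℂ • x - ⟪z, r⟫_ℂ • z)
  rw [norm_inner_symm (z - _) (x - _), ← sq] at h1
  rw [norm_inner_symm (_ - _) r, ← sq] at h2
  simp only [inner_sub_left, inner_sub_right, inner_smul_left, inner_smul_right, hxx, hzz, hrr,
    hxr, hzr, hzx] at h1 h2
  generalize ⟪r, x⟫_ℂ = α at *
  generalize ⟪r, z⟫_ℂ = β at *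
  generalize ⟪x, z⟫_ℂ = s at *
  apply Real.abs_le_sqrt
  simp only [Complex.sq_norm, Complex.normSq_apply] at h1 h2 ⊢
  simp at h1 h2
  nlinarith [h1, h2]
end

section
/- For any three unit vectors x, z, r in ℂ², setting a = |⟨r, x⟩|², b = |⟨r, z⟩|², and c = |⟨x, z⟩|², one has a + b ≥ 1 − √c. -/
open scoped InnerProductSpace

theorem aux_bessel (x z s : EuclideanSpace ℂ (Fin 2))
    (hx : ‖x‖ = 1) (hz : ‖z‖ = 1) (hs : ‖s‖ = 1) :
    ‖⟪x, s⟫_ℂ‖ ^ 2 + ‖⟪z, s⟫_ℂ‖ ^ 2 ≤ 1 + ‖⟪x, z⟫_ℂ‖ := by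
  set α := ⟪x, s⟫_ℂ with hα
  set β := ⟪z, s⟫_ℂ with hβ
  set P := ‖α‖ ^ 2 + ‖β‖ ^ 2 with hP
  have h1 : ⟪α • x + β • z, s⟫_ℂ = (P : ℂ) := by
    rw [inner_add_left, inner_smul_left, inner_smul_left, ← hα, ← hβ, Complex.conj_mul',
      Complex.conj_mul', hP]
    push_cast
    rfl
  have hP0 : 0 ≤ P := by positivity
  have h2 : P ≤ ‖α • x + β • z‖ := by
    have := norm_inner_le_norm (𝕜 := ℂ) (α • x + β • z) s
    rw [h1, hs, mul_one, Complex.norm_real, Real.norm_of_nonneg hP0] at this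
    exact this
  have h3 : ‖α • x + β • z‖ ^ 2 ≤ P + 2 * (‖α‖ * ‖β‖ * ‖⟪x, z⟫_ℂ‖) := by
    rw [@norm_add_sq ℂ, norm_smul, norm_smul, hx, hz]
    have : RCLike.re ⟪α • x, β • z⟫_ℂ ≤ ‖α‖ * ‖β‖ * ‖⟪x, z⟫_ℂ‖ := by
      refine (RCLike.re_le_norm _).trans (le_of_eq ?_)
      rw [inner_smul_left, inner_smul_right, norm_mul, norm_mul, RCLike.norm_conj]
      ring
    rw [hP]
    linarith
  have hc := norm_nonneg ⟪x, z⟫_ℂ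
  have h4 : 2 * (‖α‖ * ‖β‖ * ‖⟪x, z⟫_ℂ‖) ≤ P * ‖⟪x, z⟫_ℂ‖ := by
    rw [hP]
    nlinarith [mul_nonneg (sq_nonneg (‖α‖ - ‖β‖)) hc]
  have h5 : P ^ 2 ≤ ‖α • x + β • z‖ ^ 2 := by gcongr
  by_contra! h
  nlinarith

theorem aux_lagrange (x r : EuclideanSpace ℂ (Fin 2)) :
    ‖⟪r, x⟫_ℂ‖ ^ 2 + ‖⟪x, !₂[-star (r 1), star (r 0)]⟫_ℂ‖ ^ 2 = ‖x‖ ^ 2 * ‖r‖ ^ 2 := by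
  simp only [EuclideanSpace.norm_sq_eq, PiLp.inner_apply, Fin.sum_univ_two, ← Complex.normSq_eq_norm_sq]
  simp [Complex.normSq_apply]
  ring

/-- For three unit vectors `x, z, r` in `ℂ²`, with `a = |⟨r,x⟩|²`, `b = |⟨r,z⟩|²`,
`c = |⟨x,z⟩|²`, one has `a + b ≥ 1 - √c`. -/
theorem stmt3 (x z r : EuclideanSpace ℂ (Fin 2))
    (hx : ‖x‖ = 1) (hz : ‖z‖ = 1) (hr : ‖r‖ = 1) :
    1 - Real.sqrt (‖⟪x, z⟫_ℂ‖ ^ 2) ≤ ‖⟪r, x⟫_ℂ‖ ^ 2 + ‖⟪r, z⟫_ℂ‖ ^ 2 := by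
  rw [Real.sqrt_sq (norm_nonneg _)]
  have hs : ‖(!₂[-star (r 1), star (r 0)] : EuclideanSpace ℂ (Fin 2))‖ = 1 := by
    rw [← hr, EuclideanSpace.norm_eq, EuclideanSpace.norm_eq]
    simp [Fin.sum_univ_two, add_comm]
  have h := aux_bessel x z _ hx hz hs
  have h1 := aux_lagrange x r
  have h2 := aux_lagrange z r
  rw [hx, hr] at h1
  rw [hz, hr] at h2
  linarith
end

section
/- Let f : [0,1] → ℝ be a concave function satisfying f(x) = f(1 − x) for all x ∈ [0,1], and let c ∈ [1/2, 1]. Then for all a, b ∈ [0,1] satisfying 1 − √c ≤ a + b ≤ 1 + √c and |a − b| ≤ √(1 − c), one has f(a) + f(b) ≥ f(0) + f(√c). -/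
theorem stmt4_mono (f : ℝ → ℝ) (hconc : ConcaveOn ℝ (Set.Icc 0 1) f)
    (hsym : ∀ x ∈ Set.Icc (0 : ℝ) 1, f x = f (1 - x)) (x y : ℝ)
    (hx : 0 ≤ x) (hxy : x ≤ y) (hy : y ≤ 1/2) : f x ≤ f y := by
  have h := hconc.min_le_of_mem_Icc (x := x) (y := 1 - x) (z := y)
    ⟨by linarith, by linarith⟩ ⟨by linarith, by linarith⟩ ⟨by linarith, by linarith⟩
  rw [← hsym x ⟨by linarith, by linarith⟩, min_self] at h
  exact h

theorem stmt4_key (f : ℝ → ℝ) (hconc : ConcaveOn ℝ (Set.Icc 0 1) f)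
    (hsym : ∀ x ∈ Set.Icc (0 : ℝ) 1, f x = f (1 - x)) (p q m : ℝ)
    (hp : 0 ≤ p) (hp2 : p ≤ 1/2) (hq : 0 ≤ q) (hq2 : q ≤ 1/2) (hm : 0 ≤ m) (hm2 : m ≤ 1/2)
    (h : m ≤ p + q) : f 0 + f m ≤ f p + f q := by
  have mono := stmt4_mono f hconc hsym
  rcases le_or_gt m p with h1 | h1
  · linarith [mono m p hm h1 hp2, mono 0 q le_rfl hq hq2]
  rcases le_or_gt m q with h2 | h2
  · linarith [mono m q hm h2 hq2, mono 0 p le_rfl hp hp2]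
  have m0 : 0 < m := by linarith
  have chord : ∀ r, 0 ≤ r → r ≤ m → r / m * f m + (1 - r / m) * f 0 ≤ f r := by
    intro r hr hrm
    have hle : r / m ≤ 1 := (div_le_one m0).2 hrm
    have hmm : m ∈ Set.Icc (0 : ℝ) 1 := ⟨by linarith, by linarith⟩
    have h00 : (0 : ℝ) ∈ Set.Icc (0 : ℝ) 1 := ⟨le_rfl, by norm_num⟩
    have hr0 : 0 ≤ r / m := by positivity
    have h3 := hconc.2 hmm h00 hr0 (sub_nonneg.2 hle) (by ring)
    simp only [smul_eq_mul, mul_zero, add_zero] at h3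
    rwa [div_mul_cancel₀ r m0.ne'] at h3
  have c1 := chord p hp h1.le
  have c2 := chord q hq h2.le
  have c3 : 1 ≤ p / m + q / m := by
    rw [← add_div]; exact (one_le_div m0).2 h
  nlinarith [mono 0 m le_rfl hm hm2]

/-- Optimization lemma: for `f` concave on `[0,1]`, symmetric about `1/2`, and
`c ∈ [1/2, 1]`, any `a, b ∈ [0,1]` with `1 - √c ≤ a + b ≤ 1 + √c` and
`|a - b| ≤ √(1 - c)` satisfy `f a + f b ≥ f 0 + f (√c)`. -/
theorem stmt4 (f : ℝ → ℝ) (hconc : ConcaveOn ℝ (Set.Icc 0 1) f)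
    (hsym : ∀ x ∈ Set.Icc (0 : ℝ) 1, f x = f (1 - x))
    (c : ℝ) (hc : c ∈ Set.Icc (1/2 : ℝ) 1)
    (a b : ℝ) (ha : a ∈ Set.Icc (0 : ℝ) 1) (hb : b ∈ Set.Icc (0 : ℝ) 1)
    (hlow : 1 - Real.sqrt c ≤ a + b) (hhigh : a + b ≤ 1 + Real.sqrt c)
    (hdiff : |a - b| ≤ Real.sqrt (1 - c)) :
    f 0 + f (Real.sqrt c) ≤ f a + f b := by
  obtain ⟨hc1, hc2⟩ := hc
  obtain ⟨ha0, ha1⟩ := ha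
  obtain ⟨hb0, hb1⟩ := hb
  have s1 : √c ≤ 1 := Real.sqrt_le_one.2 hc2
  have s0 : 1/2 ≤ √c := Real.le_sqrt_of_sq_le (by linarith)
  have hds : √(1 - c) ≤ √c := Real.sqrt_le_sqrt (by linarith)
  obtain ⟨d1, d2⟩ := abs_le.1 hdiff
  have key := stmt4_key f hconc hsym
  rw [hsym (√c) ⟨by linarith, s1⟩]
  rcases le_total a (1/2) with h1 | h1 <;> rcases le_total b (1/2) with h2 | h2
  · apply key <;> linarith
  · rw [hsym b ⟨hb0, hb1⟩]; apply key <;> linarith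
  · rw [hsym a ⟨ha0, ha1⟩]; apply key <;> linarith
  · rw [hsym a ⟨ha0, ha1⟩, hsym b ⟨hb0, hb1⟩]; apply key <;> linarith
end

section
/- Let x, z, r be unit vectors in ℂ² and p ∈ [0,1]. Set a = |⟨r, x⟩|², b = |⟨r, z⟩|², c = |⟨x, z⟩|², and assume c ≥ 1/2. Then H(a·p + (1−a)·(1−p)) + H(b·p + (1−b)·(1−p)) ≥ H(p) + H(√c·p + (1−√c)·(1−p)), where H is the binary entropy function. (This is the qubit quantum uncertainty relation for the relative entropy of coherence: for a qubit state ρ = p|r⟩⟨r| + (1−p)|r_⊥⟩⟨r_⊥|, C_RE^X(ρ) + C_RE^Z(ρ) ≥ H((√(2P−1)(2√c−1)+1)/2) − H(ρ), where P = Tr(ρ²) is the purity.) -/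
open scoped InnerProductSpace

lemma binEntropy_major (p w u v : ℝ) (hp1 : p ≤ 1) (hw : 1/2 ≤ w) (hwp : w ≤ p)
    (hu : 1/2 ≤ u) (hv : 1/2 ≤ v) (hup : u ≤ p) (hvp : v ≤ p) (huv : u + v ≤ p + w) :
    Real.binEntropy p + Real.binEntropy w ≤ Real.binEntropy u + Real.binEntropy v := by
  have anti : ∀ s t : ℝ, 1/2 ≤ s → s ≤ t → t ≤ 1 → Real.binEntropy t ≤ Real.binEntropy s := by
    intro s t hs hst ht
    exact Real.binEntropy_strictAntiOn.antitoneOn ⟨by linarith, by linarith⟩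
      ⟨by linarith, by linarith⟩ hst
  by_cases h1 : u ≤ w
  · have := anti u w hu h1 (by linarith)
    have := anti v p hv hvp hp1
    linarith
  by_cases h2 : v ≤ w
  · have := anti v w hv h2 (by linarith)
    have := anti u p hu hup hp1
    linarith
  push Not at h1 h2
  have hpw : 0 < p - w := by linarith
  have e1 := anti u (p + w - v) hu (by linarith) (by linarith)
  have conc := Real.strictConcave_binEntropy.concaveOn
  have hpm : p ∈ Set.Icc (0:ℝ) 1 := ⟨by linarith, hp1⟩
  have hwm : w ∈ Set.Icc (0:ℝ) 1 := ⟨by linarith, by linarith⟩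
  have hl0 : 0 ≤ (v - w) / (p - w) := div_nonneg (by linarith) hpw.le
  have hl1 : (v - w) / (p - w) ≤ 1 := by rw [div_le_one hpw]; linarith
  have hl : (v - w) / (p - w) * (p - w) = v - w := div_mul_cancel₀ _ hpw.ne'
  generalize (v - w) / (p - w) = l at hl0 hl1 hl
  have c1 := conc.2 hpm hwm hl0 (sub_nonneg.2 hl1) (by ring)
  have c2 := conc.2 hpm hwm (sub_nonneg.2 hl1) hl0 (by ring)
  simp only [smul_eq_mul] at c1 c2
  rw [show l * p + (1 - l) * w = v by linarith] at c1
  rw [show (1 - l) * p + l * w = p + w - v by linarith] at c2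
  linarith

lemma entropy_part (p a b k : ℝ) (hp : 1/2 ≤ p) (hp1 : p ≤ 1) (ha0 : 0 ≤ a) (ha1 : a ≤ 1)
    (hb0 : 0 ≤ b) (hb1 : b ≤ 1) (hk : 1/2 ≤ k) (hk1 : k ≤ 1)
    (h1 : |a + b - 1| ≤ k) (h2 : |a - b| ≤ k) :
    Real.binEntropy p + Real.binEntropy (k * p + (1 - k) * (1 - p))
    ≤ Real.binEntropy (a * p + (1 - a) * (1 - p))
      + Real.binEntropy (b * p + (1 - b) * (1 - p)) := by
  have key : ∀ a b : ℝ, 1/2 ≤ a → 1/2 ≤ b → a ≤ 1 → b ≤ 1 → a + b - 1 ≤ k →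
      Real.binEntropy p + Real.binEntropy (k * p + (1 - k) * (1 - p))
      ≤ Real.binEntropy (a * p + (1 - a) * (1 - p))
        + Real.binEntropy (b * p + (1 - b) * (1 - p)) := by
    intro a b ha hb ha1 hb1 hab
    apply binEntropy_major <;> nlinarith
  have flip : ∀ a : ℝ, Real.binEntropy ((1 - a) * p + (1 - (1 - a)) * (1 - p))
      = Real.binEntropy (a * p + (1 - a) * (1 - p)) := by
    intro a
    rw [← Real.binEntropy_one_sub]
    congr 1; ring
  rw [abs_le] at h1 h2
  rcases le_total (1/2) a with h | h <;> rcases le_total (1/2) b with h' | h'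
  · exact key a b h h' ha1 hb1 (by linarith)
  · rw [← flip b]
    exact key a (1 - b) h (by linarith) ha1 (by linarith) (by linarith)
  · rw [← flip a]
    exact key (1 - a) b (by linarith) h' (by linarith) hb1 (by linarith)
  · rw [← flip a, ← flip b]
    exact key (1 - a) (1 - b) (by linarith) (by linarith) (by linarith) (by linarith) (by linarith)

/-- Bloch vectors of the qubit unit vectors. -/
lemma bloch_exists (x : EuclideanSpace ℂ (Fin 2)) : ∃ X1 X2 X3 : ℝ,
    X1 = 2 * ((x 0).re * (x 1).re + (x 0).im * (x 1).im) ∧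
    X2 = 2 * ((x 0).re * (x 1).im - (x 0).im * (x 1).re) ∧
    X3 = (x 0).re ^ 2 + (x 0).im ^ 2 - (x 1).re ^ 2 - (x 1).im ^ 2 :=
  ⟨_, _, _, rfl, rfl, rfl⟩

lemma norm_coords (x : EuclideanSpace ℂ (Fin 2)) (hx : ‖x‖ = 1) :
    (x 0).re ^ 2 + (x 0).im ^ 2 + (x 1).re ^ 2 + (x 1).im ^ 2 = 1 := by
  have h := EuclideanSpace.norm_sq_eq x
  rw [hx, Fin.sum_univ_two, Complex.sq_norm, Complex.sq_norm, Complex.normSq_apply,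
    Complex.normSq_apply] at h
  linarith

lemma inner_coords (x z : EuclideanSpace ℂ (Fin 2)) :
    ‖⟪x, z⟫_ℂ‖ ^ 2 =
      ((x 0).re * (z 0).re + (x 0).im * (z 0).im + (x 1).re * (z 1).re + (x 1).im * (z 1).im) ^ 2
      + ((x 0).re * (z 0).im - (x 0).im * (z 0).re
        + (x 1).re * (z 1).im - (x 1).im * (z 1).re) ^ 2 := by
  rw [Complex.sq_norm, Complex.normSq_apply, PiLp.inner_apply, Fin.sum_univ_two]
  simp
  ring

lemma bloch_inner (x z : EuclideanSpace ℂ (Fin 2)) (hx : ‖x‖ = 1) (hz : ‖z‖ = 1)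
    (X1 X2 X3 Z1 Z2 Z3 : ℝ)
    (h1 : X1 = 2 * ((x 0).re * (x 1).re + (x 0).im * (x 1).im))
    (h2 : X2 = 2 * ((x 0).re * (x 1).im - (x 0).im * (x 1).re))
    (h3 : X3 = (x 0).re ^ 2 + (x 0).im ^ 2 - (x 1).re ^ 2 - (x 1).im ^ 2)
    (k1 : Z1 = 2 * ((z 0).re * (z 1).re + (z 0).im * (z 1).im))
    (k2 : Z2 = 2 * ((z 0).re * (z 1).im - (z 0).im * (z 1).re))
    (k3 : Z3 = (z 0).re ^ 2 + (z 0).im ^ 2 - (z 1).re ^ 2 - (z 1).im ^ 2) :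
    X1 * Z1 + X2 * Z2 + X3 * Z3 = 2 * ‖⟪x, z⟫_ℂ‖ ^ 2 - 1 := by
  have hm : (1 : ℝ) = ((x 0).re ^ 2 + (x 0).im ^ 2 + (x 1).re ^ 2 + (x 1).im ^ 2)
      * ((z 0).re ^ 2 + (z 0).im ^ 2 + (z 1).re ^ 2 + (z 1).im ^ 2) := by
    rw [norm_coords x hx, norm_coords z hz, one_mul]
  rw [inner_coords]
  conv_rhs => rw [hm]
  subst h1 h2 h3 k1 k2 k3
  ring

lemma cs3 (a b c d e f : ℝ) :
    (a * d + b * e + c * f) ^ 2 ≤ (a * a + b * b + c * c) * (d * d + e * e + f * f) := by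
  nlinarith [sq_nonneg (a * e - b * d), sq_nonneg (a * f - c * d), sq_nonneg (b * f - c * e)]

lemma bloch_real (X1 X2 X3 Z1 Z2 Z3 R1 R2 R3 a b c : ℝ)
    (exz : X1 * Z1 + X2 * Z2 + X3 * Z3 = 2 * c - 1)
    (erx : R1 * X1 + R2 * X2 + R3 * X3 = 2 * a - 1)
    (erz : R1 * Z1 + R2 * Z2 + R3 * Z3 = 2 * b - 1)
    (exx : X1 * X1 + X2 * X2 + X3 * X3 = 2 * 1 - 1)
    (ezz : Z1 * Z1 + Z2 * Z2 + Z3 * Z3 = 2 * 1 - 1)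
    (err : R1 * R1 + R2 * R2 + R3 * R3 = 2 * 1 - 1) :
    (a + b - 1) ^ 2 ≤ c ∧ (a - b) ^ 2 ≤ 1 - c := by
  have c1 := cs3 R1 R2 R3 (X1 + Z1) (X2 + Z2) (X3 + Z3)
  have c2 := cs3 R1 R2 R3 (X1 - Z1) (X2 - Z2) (X3 - Z3)
  rw [err, show R1 * (X1 + Z1) + R2 * (X2 + Z2) + R3 * (X3 + Z3) = 2 * (a + b - 1) by linarith,
    show (X1 + Z1) * (X1 + Z1) + (X2 + Z2) * (X2 + Z2) + (X3 + Z3) * (X3 + Z3) = 4 * c by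
      linarith] at c1
  rw [err, show R1 * (X1 - Z1) + R2 * (X2 - Z2) + R3 * (X3 - Z3) = 2 * (a - b) by linarith,
    show (X1 - Z1) * (X1 - Z1) + (X2 - Z2) * (X2 - Z2) + (X3 - Z3) * (X3 - Z3) = 4 * (1 - c) by
      linarith] at c2
  constructor <;> linarith

lemma overlap_bounds (x z r : EuclideanSpace ℂ (Fin 2))
    (hx : ‖x‖ = 1) (hz : ‖z‖ = 1) (hr : ‖r‖ = 1) :
    (‖⟪r, x⟫_ℂ‖ ^ 2 + ‖⟪r, z⟫_ℂ‖ ^ 2 - 1) ^ 2 ≤ ‖⟪x, z⟫_ℂ‖ ^ 2 ∧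
    (‖⟪r, x⟫_ℂ‖ ^ 2 - ‖⟪r, z⟫_ℂ‖ ^ 2) ^ 2 ≤ 1 - ‖⟪x, z⟫_ℂ‖ ^ 2 := by
  obtain ⟨X1, X2, X3, hX1, hX2, hX3⟩ := bloch_exists x
  obtain ⟨Z1, Z2, Z3, hZ1, hZ2, hZ3⟩ := bloch_exists z
  obtain ⟨R1, R2, R3, hR1, hR2, hR3⟩ := bloch_exists r
  have exz := bloch_inner x z hx hz _ _ _ _ _ _ hX1 hX2 hX3 hZ1 hZ2 hZ3
  have erx := bloch_inner r x hr hx _ _ _ _ _ _ hR1 hR2 hR3 hX1 hX2 hX3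
  have erz := bloch_inner r z hr hz _ _ _ _ _ _ hR1 hR2 hR3 hZ1 hZ2 hZ3
  have exx := bloch_inner x x hx hx _ _ _ _ _ _ hX1 hX2 hX3 hX1 hX2 hX3
  have ezz := bloch_inner z z hz hz _ _ _ _ _ _ hZ1 hZ2 hZ3 hZ1 hZ2 hZ3
  have err := bloch_inner r r hr hr _ _ _ _ _ _ hR1 hR2 hR3 hR1 hR2 hR3
  have self : ∀ y : EuclideanSpace ℂ (Fin 2), ‖y‖ = 1 → ‖⟪y, y⟫_ℂ‖ ^ 2 = 1 := by
    intro y hy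
    rw [inner_self_eq_norm_sq_to_K, hy]; simp
  rw [self x hx] at exx
  rw [self z hz] at ezz
  rw [self r hr] at err
  exact bloch_real _ _ _ _ _ _ _ _ _ _ _ _ exz erx erz exx ezz err

/-- Qubit quantum uncertainty relation for the relative entropy of coherence:
for unit vectors `x, z, r` in `ℂ²`, `p ∈ [0,1]`, with `a = |⟨r,x⟩|²`, `b = |⟨r,z⟩|²`,
`c = |⟨x,z⟩|² ≥ 1/2`, one has
`H(ap+(1-a)(1-p)) + H(bp+(1-b)(1-p)) ≥ H(p) + H(√c·p+(1-√c)(1-p))`. -/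
theorem stmt6 (x z r : EuclideanSpace ℂ (Fin 2)) (p : ℝ) (hp : p ∈ Set.Icc (0 : ℝ) 1)
    (hx : ‖x‖ = 1) (hz : ‖z‖ = 1) (hr : ‖r‖ = 1)
    (a b c : ℝ)
    (ha : a = ‖⟪r, x⟫_ℂ‖ ^ 2) (hb : b = ‖⟪r, z⟫_ℂ‖ ^ 2) (hc : c = ‖⟪x, z⟫_ℂ‖ ^ 2)
    (hc2 : (1/2 : ℝ) ≤ c) :
    Real.binEntropy p
      + Real.binEntropy (Real.sqrt c * p + (1 - Real.sqrt c) * (1 - p))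
    ≤ Real.binEntropy (a * p + (1 - a) * (1 - p))
      + Real.binEntropy (b * p + (1 - b) * (1 - p)) := by
  have bd : ∀ y w : EuclideanSpace ℂ (Fin 2), ‖y‖ = 1 → ‖w‖ = 1 → ‖⟪y, w⟫_ℂ‖ ^ 2 ≤ 1 := by
    intro y w hy hw
    have := norm_inner_le_norm (𝕜 := ℂ) y w
    rw [hy, hw, one_mul] at this
    exact pow_le_one₀ (norm_nonneg _) this
  have ha0 : 0 ≤ a := by rw [ha]; positivity
  have hb0 : 0 ≤ b := by rw [hb]; positivity
  have ha1 : a ≤ 1 := by rw [ha]; exact bd r x hr hx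
  have hb1 : b ≤ 1 := by rw [hb]; exact bd r z hr hz
  have hc1 : c ≤ 1 := by rw [hc]; exact bd x z hx hz
  obtain ⟨o1, o2⟩ := overlap_bounds x z r hx hz hr
  rw [← ha, ← hb, ← hc] at o1 o2
  have hk : 1/2 ≤ Real.sqrt c := Real.le_sqrt_of_sq_le (by linarith)
  have hk1 : Real.sqrt c ≤ 1 := Real.sqrt_le_one.2 hc1
  have h1 : |a + b - 1| ≤ Real.sqrt c := Real.abs_le_sqrt o1
  have h2 : |a - b| ≤ Real.sqrt c := Real.abs_le_sqrt (by linarith)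
  rcases le_total (1/2) p with h | h
  · exact entropy_part p a b _ h hp.2 ha0 ha1 hb0 hb1 hk hk1 h1 h2
  · have := entropy_part (1 - p) a b _ (by linarith) (by linarith [hp.1]) ha0 ha1 hb0 hb1 hk hk1 h1 h2
    have flip : ∀ a : ℝ, Real.binEntropy (a * (1 - p) + (1 - a) * (1 - (1 - p)))
        = Real.binEntropy (a * p + (1 - a) * (1 - p)) := by
      intro a
      rw [← Real.binEntropy_one_sub]
      congr 1; ring
    rw [flip, flip, flip, Real.binEntropy_one_sub] at this
    exact this
end

section
/- Fix t ∈ [0,1]. The function g : [0,1] → ℝ defined by g(x) = H((1 + √(1 − 4t²·x·(1−x)))/2), where H is the binary entropy function, is concave on [0,1] and satisfies g(x) = g(1−x) for all x ∈ [0,1]. -/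
lemma sqrt_aux_bounds (t : ℝ) (ht : t ∈ Set.Icc (0 : ℝ) 1) (x : ℝ) (hx : x ∈ Set.Icc (0 : ℝ) 1) :
    0 ≤ 1 - 4 * t ^ 2 * x * (1 - x) ∧ Real.sqrt (1 - 4 * t ^ 2 * x * (1 - x)) ≤ 1 := by
  obtain ⟨h0, h1⟩ := ht
  obtain ⟨hx0, hx1⟩ := hx
  have h2 : t ^ 2 ≤ 1 := by nlinarith
  have hp : 0 ≤ x * (1 - x) := mul_nonneg hx0 (by linarith)
  have h3 : 0 ≤ t ^ 2 * (x * (1 - x)) := mul_nonneg (sq_nonneg t) hp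
  have h4 : 0 ≤ (1 - t ^ 2) * (x * (1 - x)) := mul_nonneg (by linarith) hp
  constructor
  · nlinarith [sq_nonneg (1 - 2 * x)]
  · rw [Real.sqrt_le_one]
    nlinarith

lemma sqrt_aux_convex (t : ℝ) (ht : t ∈ Set.Icc (0 : ℝ) 1) (x y a b : ℝ)
    (hx : x ∈ Set.Icc (0 : ℝ) 1) (hy : y ∈ Set.Icc (0 : ℝ) 1)
    (ha : 0 ≤ a) (hb : 0 ≤ b) (hab : a + b = 1) :
    Real.sqrt (1 - 4 * t ^ 2 * (a * x + b * y) * (1 - (a * x + b * y))) ≤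
      a * Real.sqrt (1 - 4 * t ^ 2 * x * (1 - x)) +
      b * Real.sqrt (1 - 4 * t ^ 2 * y * (1 - y)) := by
  have hX := (sqrt_aux_bounds t ht x hx).1
  have hY := (sqrt_aux_bounds t ht y hy).1
  have h2 : t ^ 2 ≤ 1 := by nlinarith [ht.1, ht.2]
  have hcross : (1 - t ^ 2) + t ^ 2 * ((1 - 2 * x) * (1 - 2 * y)) ≤
      Real.sqrt (1 - 4 * t ^ 2 * x * (1 - x)) * Real.sqrt (1 - 4 * t ^ 2 * y * (1 - y)) := by
    rw [← Real.sqrt_mul hX]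
    apply Real.le_sqrt_of_sq_le
    have : 0 ≤ (1 - t ^ 2) * t ^ 2 * (x - y) ^ 2 :=
      mul_nonneg (mul_nonneg (by linarith) (sq_nonneg t)) (sq_nonneg _)
    nlinarith
  have sX := Real.sq_sqrt hX
  have sY := Real.sq_sqrt hY
  set p := Real.sqrt (1 - 4 * t ^ 2 * x * (1 - x))
  set q := Real.sqrt (1 - 4 * t ^ 2 * y * (1 - y))
  apply Real.sqrt_le_iff.2
  refine ⟨add_nonneg (mul_nonneg ha (Real.sqrt_nonneg _)) (mul_nonneg hb (Real.sqrt_nonneg _)), ?_⟩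
  have hc := mul_le_mul_of_nonneg_left hcross (mul_nonneg ha hb)
  have e : (a * p + b * q) ^ 2 = a ^ 2 * p ^ 2 + b ^ 2 * q ^ 2 + 2 * (a * b * (p * q)) := by ring
  rw [e, sX, sY]
  obtain rfl : b = 1 - a := by linarith
  nlinarith

/-- For fixed `t ∈ [0,1]`, the function `x ↦ H((1 + √(1 - 4t²x(1-x)))/2)`, where `H`
is the binary entropy function, is concave on `[0,1]` and symmetric about `x = 1/2`. -/
theorem stmt7 (t : ℝ) (ht : t ∈ Set.Icc (0 : ℝ) 1) :
    ConcaveOn ℝ (Set.Icc 0 1)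
      (fun x : ℝ =>
        Real.binEntropy ((1 + Real.sqrt (1 - 4 * t ^ 2 * x * (1 - x))) / 2)) ∧
    ∀ x ∈ Set.Icc (0 : ℝ) 1,
      Real.binEntropy ((1 + Real.sqrt (1 - 4 * t ^ 2 * x * (1 - x))) / 2)
        = Real.binEntropy
            ((1 + Real.sqrt (1 - 4 * t ^ 2 * (1 - x) * (1 - (1 - x)))) / 2) := by
  constructor
  · refine ⟨convex_Icc 0 1, ?_⟩
    intro x hx y hy a b ha hb hab
    have hz : a * x + b * y ∈ Set.Icc (0 : ℝ) 1 := convex_Icc (0 : ℝ) 1 hx hy ha hb hab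
    have hs := sqrt_aux_convex t ht x y a b hx hy ha hb hab
    have hX := (sqrt_aux_bounds t ht x hx).2
    have hY := (sqrt_aux_bounds t ht y hy).2
    have hZ := (sqrt_aux_bounds t ht _ hz).2
    simp only [smul_eq_mul]
    have hp := Real.sqrt_nonneg (1 - 4 * t ^ 2 * x * (1 - x))
    have hq := Real.sqrt_nonneg (1 - 4 * t ^ 2 * y * (1 - y))
    have hr := Real.sqrt_nonneg (1 - 4 * t ^ 2 * (a * x + b * y) * (1 - (a * x + b * y)))
    set p := Real.sqrt (1 - 4 * t ^ 2 * x * (1 - x))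
    set q := Real.sqrt (1 - 4 * t ^ 2 * y * (1 - y))
    set r := Real.sqrt (1 - 4 * t ^ 2 * (a * x + b * y) * (1 - (a * x + b * y)))
    have h1 := Real.strictConcave_binEntropy.concaveOn.2
      (show (1 + p) / 2 ∈ Set.Icc (0 : ℝ) 1 from ⟨by linarith, by linarith⟩)
      (show (1 + q) / 2 ∈ Set.Icc (0 : ℝ) 1 from ⟨by linarith, by linarith⟩) ha hb hab
    simp only [smul_eq_mul] at h1
    have e : a * ((1 + p) / 2) + b * ((1 + q) / 2) = (1 + (a * p + b * q)) / 2 := by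
      linear_combination hab / 2
    rw [e] at h1
    have hle : a * p + b * q ≤ 1 := by nlinarith
    refine h1.trans (Real.binEntropy_strictAntiOn.antitoneOn ?_ ?_ ?_)
    · constructor <;> norm_num <;> linarith
    · constructor <;> norm_num <;> linarith
    · linarith
  · intro x _
    congr 4
    ring
end

section
/- Let x, z, r be unit vectors in ℂ² and p ∈ [0,1]; set t = |2p − 1|, a = |⟨r, x⟩|², b = |⟨r, z⟩|², c = |⟨x, z⟩|², and assume c ≥ 1/2. Define g(x) = H((1 + √(1 − 4t²·x·(1−x)))/2), where H is the binary entropy function. Then g(a) + g(b) ≥ H((1 + √(1 − 4t²·√c·(1−√c)))/2). (This is the qubit quantum uncertainty relation for the coherence of formation: C_CF^X(ρ) + C_CF^Z(ρ) ≥ H((1+√(1−4(2P−1)√c(1−√c)))/2) for a qubit state ρ of purity P = Tr(ρ²).) -/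
open scoped InnerProductSpace

namespace Stmt8Aux

open Real

/-- `(1-q)² log(1-q) - q² log q ≥ 0` on `[1/2,1)`. -/
lemma phi_nonneg (q : ℝ) (h1 : 1 / 2 ≤ q) (h2 : q < 1) :
    0 ≤ (1 - q) ^ 2 * log (1 - q) - q ^ 2 * log q := by
  set f : ℝ → ℝ := fun q => (1 - q) * ((1 - q) * log (1 - q)) - q * (q * log q) with hf
  have hcont : Continuous f := by
    have h := Real.continuous_mul_log
    have h' : Continuous fun q : ℝ => (1 - q) * log (1 - q) := h.comp (by fun_prop : Continuous fun q : ℝ => 1 - q)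
    exact ((by fun_prop : Continuous fun q : ℝ => 1 - q).mul h').sub (continuous_id.mul h)
  have hd : ∀ y ∈ Set.Ioo (1/2 : ℝ) 1, HasDerivAt f (2 * binEntropy y - 1) y := by
    intro y hy
    have hy0 : y ≠ 0 := by have := hy.1; intro h; rw [h] at this; norm_num at this
    have hy1 : 1 - y ≠ 0 := by have := hy.2; intro h; linarith
    have e1 : HasDerivAt (fun q : ℝ => 1 - q) (-1) y := by
      simpa using (hasDerivAt_id y).const_sub 1
    have e2 := e1.log hy1
    have e3 := (e1.mul (e1.mul e2)).sub
      ((hasDerivAt_id y).mul ((hasDerivAt_id y).mul (Real.hasDerivAt_log hy0)))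
    refine e3.congr_deriv ?_
    rw [binEntropy_eq_negMulLog_add_negMulLog_one_sub]
    simp only [negMulLog, Pi.mul_apply, id]
    field_simp
    ring
  have hconc : ConcaveOn ℝ (Set.Icc (1/2 : ℝ) 1) f := by
    apply AntitoneOn.concaveOn_of_deriv (convex_Icc _ _) hcont.continuousOn
    · rw [interior_Icc]
      exact fun y hy => (hd y hy).differentiableAt.differentiableWithinAt
    · rw [interior_Icc]
      intro y hy w hw hyw
      rw [(hd y hy).deriv, (hd w hw).deriv]
      have := binEntropy_strictAntiOn.antitoneOn (a := y) (b := w)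
        ⟨by linarith [hy.1], hy.2.le⟩ ⟨by linarith [hw.1], hw.2.le⟩ hyw
      linarith
  have hm := hconc.2 (show (1/2 : ℝ) ∈ Set.Icc (1/2 : ℝ) 1 by norm_num)
    (show (1 : ℝ) ∈ Set.Icc (1/2 : ℝ) 1 by norm_num)
    (show 0 ≤ 2 * (1 - q) by linarith) (show 0 ≤ 2 * q - 1 by linarith) (by ring)
  have f1 : f (1/2) = 0 := by simp only [hf]; norm_num
  have f2 : f 1 = 0 := by simp [hf]
  rw [f1, f2] at hm
  simp only [smul_eq_mul] at hm
  rw [show 2 * (1 - q) * (1 / 2) + (2 * q - 1) * 1 = q by ring] at hm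
  simp only [hf] at hm
  linarith

lemma ratio_mono : MonotoneOn (fun q : ℝ => binEntropy q / (q * (1 - q))) (Set.Ico (1/2) 1) := by
  have hd : ∀ y ∈ Set.Ico (1/2 : ℝ) 1, HasDerivAt (fun q : ℝ => binEntropy q / (q * (1 - q)))
      (((1 - y) ^ 2 * log (1 - y) - y ^ 2 * log y) / (y * (1 - y)) ^ 2) y := by
    intro y hy
    have hy0 : y ≠ 0 := by have := hy.1; intro h; rw [h] at this; norm_num at this
    have hy1 : 1 - y ≠ 0 := by have := hy.2; intro h; linarith
    have e1 : HasDerivAt (fun q : ℝ => 1 - q) (-1) y := by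
      simpa using (hasDerivAt_id y).const_sub 1
    have e := (Real.hasDerivAt_binEntropy hy0 (by intro h; apply hy1; linarith)).div
      ((hasDerivAt_id y).mul e1) (mul_ne_zero hy0 hy1)
    refine e.congr_deriv ?_
    simp only [Pi.mul_apply, id]
    congr 1
    rw [binEntropy_eq_negMulLog_add_negMulLog_one_sub]
    simp only [negMulLog]
    ring
  apply monotoneOn_of_deriv_nonneg (convex_Ico _ _)
  · exact fun y hy => (hd y hy).continuousAt.continuousWithinAt
  · exact fun y hy => (hd y (interior_subset hy)).differentiableAt.differentiableWithinAt
  · intro y hy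
    have hy := interior_subset hy
    rw [(hd y hy).deriv]
    exact div_nonneg (phi_nonneg y hy.1 hy.2) (sq_nonneg _)

noncomputable def F (s : ℝ) : ℝ := binEntropy ((1 + √(1 - s)) / 2)

lemma q_mem (s : ℝ) (h0 : 0 ≤ s) : 1/2 ≤ (1 + √(1 - s)) / 2 ∧ (1 + √(1 - s)) / 2 ≤ 1 := by
  have h : √(1 - s) ≤ 1 := Real.sqrt_le_one.2 (by linarith)
  have := Real.sqrt_nonneg (1 - s)
  constructor <;> linarith

lemma F_nonneg (s : ℝ) (h0 : 0 ≤ s) : 0 ≤ F s := by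
  have := q_mem s h0
  exact binEntropy_nonneg (by linarith) this.2

lemma F_mono {s u : ℝ} (h0 : 0 ≤ s) (h : s ≤ u) : F s ≤ F u := by
  have h1 := q_mem s h0
  have h2 := q_mem u (h0.trans h)
  have h3 : √(1 - u) ≤ √(1 - s) := Real.sqrt_le_sqrt (by linarith)
  exact binEntropy_strictAntiOn.antitoneOn ⟨by linarith, h2.2⟩ ⟨by linarith, h1.2⟩ (by linarith)

lemma F_star {u s : ℝ} (hu : 0 ≤ u) (hus : u ≤ s) (hs : s ≤ 1) : u * F s ≤ s * F u := by
  rcases hu.eq_or_lt with rfl | hu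
  · simpa using mul_nonneg hus (F_nonneg 0 le_rfl)
  have key : ∀ v : ℝ, 0 < v → v ≤ 1 → (1 + √(1 - v)) / 2 ∈ Set.Ico (1/2 : ℝ) 1 ∧
      (1 + √(1 - v)) / 2 * (1 - (1 + √(1 - v)) / 2) = v / 4 := by
    intro v h0 h1
    have hq := q_mem v h0.le
    have hsq := Real.sq_sqrt (show 0 ≤ 1 - v by linarith)
    have hlt : √(1 - v) < 1 := by nlinarith [Real.sqrt_nonneg (1 - v)]
    exact ⟨⟨hq.1, by linarith⟩, by nlinarith⟩
  obtain ⟨a1, a2⟩ := key u hu (hus.trans hs)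
  obtain ⟨b1, b2⟩ := key s (hu.trans_le hus) hs
  have h3 : √(1 - s) ≤ √(1 - u) := Real.sqrt_le_sqrt (by linarith)
  have h := ratio_mono b1 a1 (by linarith)
  simp only [a2, b2] at h
  change F s / (s / 4) ≤ F u / (u / 4) at h
  rw [div_le_div_iff₀ (by linarith) (by linarith)] at h
  linarith

lemma F_sub {s u v : ℝ} (hu : 0 ≤ u) (hv : 0 ≤ v) (hs0 : 0 ≤ s) (hs : s ≤ 1) (h : s ≤ u + v) :
    F s ≤ F u + F v := by
  have nu := F_nonneg u hu
  have nv := F_nonneg v hv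
  by_cases h1 : s ≤ u
  · linarith [F_mono hs0 h1]
  by_cases h2 : s ≤ v
  · linarith [F_mono hs0 h2]
  have h1 := not_le.1 h1
  have h2 := not_le.1 h2
  have e1 := F_star hu h1.le hs
  have e2 := F_star hv h2.le hs
  have e3 := mul_le_mul_of_nonneg_right h (F_nonneg s hs0)
  have : s * F s ≤ s * (F u + F v) := by linarith
  exact le_of_mul_le_mul_left this (hu.trans_lt h1)

lemma gram_vec (a1 a2 a3 b1 b2 b3 c1 c2 c3 A B K : ℝ)
    (ha : a1 ^ 2 + a2 ^ 2 + a3 ^ 2 = 1) (hb : b1 ^ 2 + b2 ^ 2 + b3 ^ 2 = 1)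
    (hc : c1 ^ 2 + c2 ^ 2 + c3 ^ 2 = 1)
    (hA : a1 * b1 + a2 * b2 + a3 * b3 = A) (hB : a1 * c1 + a2 * c2 + a3 * c3 = B)
    (hK : b1 * c1 + b2 * c2 + b3 * c3 = K) :
    0 ≤ 1 + 2 * A * B * K - A ^ 2 - B ^ 2 - K ^ 2 := by
  have h := sq_nonneg (a1 * (b2 * c3 - b3 * c2) - a2 * (b1 * c3 - b3 * c1) + a3 * (b1 * c2 - b2 * c1))
  have e : (a1 * (b2 * c3 - b3 * c2) - a2 * (b1 * c3 - b3 * c1) + a3 * (b1 * c2 - b2 * c1)) ^ 2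
    = (a1 ^ 2 + a2 ^ 2 + a3 ^ 2) * (b1 ^ 2 + b2 ^ 2 + b3 ^ 2) * (c1 ^ 2 + c2 ^ 2 + c3 ^ 2)
      + 2 * (a1 * b1 + a2 * b2 + a3 * b3) * (a1 * c1 + a2 * c2 + a3 * c3)
        * (b1 * c1 + b2 * c2 + b3 * c3)
      - (a1 * b1 + a2 * b2 + a3 * b3) ^ 2 * (c1 ^ 2 + c2 ^ 2 + c3 ^ 2)
      - (a1 * c1 + a2 * c2 + a3 * c3) ^ 2 * (b1 ^ 2 + b2 ^ 2 + b3 ^ 2)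
      - (b1 * c1 + b2 * c2 + b3 * c3) ^ 2 * (a1 ^ 2 + a2 ^ 2 + a3 ^ 2) := by ring
  rw [ha, hb, hc, hA, hB, hK] at e
  linarith

/-- Bloch vector components. -/
noncomputable def n1 (v : EuclideanSpace ℂ (Fin 2)) : ℝ :=
  2 * ((v 0).re * (v 1).re + (v 0).im * (v 1).im)
noncomputable def n2 (v : EuclideanSpace ℂ (Fin 2)) : ℝ :=
  2 * ((v 0).re * (v 1).im - (v 0).im * (v 1).re)
noncomputable def n3 (v : EuclideanSpace ℂ (Fin 2)) : ℝ :=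
  (v 0).re ^ 2 + (v 0).im ^ 2 - (v 1).re ^ 2 - (v 1).im ^ 2

lemma norm_eq (v : EuclideanSpace ℂ (Fin 2)) (h : ‖v‖ = 1) :
    (v 0).re ^ 2 + (v 0).im ^ 2 + (v 1).re ^ 2 + (v 1).im ^ 2 = 1 := by
  have e := EuclideanSpace.norm_sq_eq v
  rw [h] at e
  simp only [Fin.sum_univ_two, Complex.sq_norm, Complex.normSq_apply] at e
  linarith

lemma bloch_unit (v : EuclideanSpace ℂ (Fin 2)) (h : ‖v‖ = 1) :
    n1 v ^ 2 + n2 v ^ 2 + n3 v ^ 2 = 1 := by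
  have e := norm_eq v h
  have : n1 v ^ 2 + n2 v ^ 2 + n3 v ^ 2 =
    ((v 0).re ^ 2 + (v 0).im ^ 2 + (v 1).re ^ 2 + (v 1).im ^ 2) ^ 2 := by
    unfold n1 n2 n3; ring
  rw [this, e]; norm_num

lemma bloch_inner (v w : EuclideanSpace ℂ (Fin 2)) (hv : ‖v‖ = 1) (hw : ‖w‖ = 1) :
    n1 v * n1 w + n2 v * n2 w + n3 v * n3 w = 2 * ‖⟪v, w⟫_ℂ‖ ^ 2 - 1 := by
  have e := norm_eq v hv
  have e' := norm_eq w hw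
  have : n1 v * n1 w + n2 v * n2 w + n3 v * n3 w = 2 * ‖⟪v, w⟫_ℂ‖ ^ 2 -
      ((v 0).re ^ 2 + (v 0).im ^ 2 + (v 1).re ^ 2 + (v 1).im ^ 2) *
      ((w 0).re ^ 2 + (w 0).im ^ 2 + (w 1).re ^ 2 + (w 1).im ^ 2) := by
    rw [Complex.sq_norm, Complex.normSq_apply, PiLp.inner_apply]
    simp only [Fin.sum_univ_two, RCLike.inner_apply, Complex.add_re, Complex.add_im,
      Complex.mul_re, Complex.mul_im, Complex.conj_re, Complex.conj_im]
    unfold n1 n2 n3; ring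
  rw [this, e, e']; norm_num

end Stmt8Aux

/-- Qubit quantum uncertainty relation for the coherence of formation:
for unit vectors `x, z, r` in `ℂ²`, `p ∈ [0,1]`, `t = |2p-1|`, `a = |⟨r,x⟩|²`,
`b = |⟨r,z⟩|²`, `c = |⟨x,z⟩|² ≥ 1/2`, and `g(x) = H((1+√(1-4t²x(1-x)))/2)`,
one has `g(a) + g(b) ≥ H((1+√(1-4t²√c(1-√c)))/2)`. -/
theorem stmt8 (x z r : EuclideanSpace ℂ (Fin 2)) (p : ℝ) (hp : p ∈ Set.Icc (0 : ℝ) 1)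
    (hx : ‖x‖ = 1) (hz : ‖z‖ = 1) (hr : ‖r‖ = 1)
    (t a b c : ℝ) (ht : t = |2 * p - 1|)
    (ha : a = ‖⟪r, x⟫_ℂ‖ ^ 2) (hb : b = ‖⟪r, z⟫_ℂ‖ ^ 2) (hc : c = ‖⟪x, z⟫_ℂ‖ ^ 2)
    (hc2 : (1/2 : ℝ) ≤ c) :
    Real.binEntropy
        ((1 + Real.sqrt (1 - 4 * t ^ 2 * Real.sqrt c * (1 - Real.sqrt c))) / 2)
      ≤ Real.binEntropy ((1 + Real.sqrt (1 - 4 * t ^ 2 * a * (1 - a))) / 2)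
        + Real.binEntropy ((1 + Real.sqrt (1 - 4 * t ^ 2 * b * (1 - b))) / 2) := by
  have hu : ∀ v w : EuclideanSpace ℂ (Fin 2), ‖v‖ = 1 → ‖w‖ = 1 → ‖⟪v, w⟫_ℂ‖ ^ 2 ≤ 1 := by
    intro v w hv hw
    have h := norm_inner_le_norm (𝕜 := ℂ) v w
    rw [hv, hw] at h
    exact pow_le_one₀ (norm_nonneg _) (by linarith)
  have ha1 : a ≤ 1 := ha ▸ hu r x hr hx
  have hb1 : b ≤ 1 := hb ▸ hu r z hr hz
  have hc1 : c ≤ 1 := hc ▸ hu x z hx hz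
  have ha0 : 0 ≤ a := ha ▸ sq_nonneg _
  have hb0 : 0 ≤ b := hb ▸ sq_nonneg _
  have hA := Stmt8Aux.bloch_inner r x hr hx
  have hB := Stmt8Aux.bloch_inner r z hr hz
  have hK := Stmt8Aux.bloch_inner x z hx hz
  rw [← ha] at hA
  rw [← hb] at hB
  rw [← hc] at hK
  have hg := Stmt8Aux.gram_vec _ _ _ _ _ _ _ _ _ _ _ _ (Stmt8Aux.bloch_unit r hr)
    (Stmt8Aux.bloch_unit x hx) (Stmt8Aux.bloch_unit z hz) hA hB hK
  have hmain : 2 * (1 - c) ≤ 4 * a * (1 - a) + 4 * b * (1 - b) := by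
    rcases hc1.eq_or_lt with h | h
    · rw [h]
      nlinarith [mul_nonneg ha0 (sub_nonneg.2 ha1), mul_nonneg hb0 (sub_nonneg.2 hb1)]
    · have h5 := mul_nonneg (show 0 ≤ 2 * c - 1 by linarith) (sq_nonneg ((2 * a - 1) - (2 * b - 1)))
      have h6 : (1 - c) * (2 * (1 - c)) ≤ (1 - c) * (4 * a * (1 - a) + 4 * b * (1 - b)) := by
        nlinarith
      exact le_of_mul_le_mul_left h6 (by linarith)
  have hs0 := Real.sqrt_nonneg c
  have hs1 : √c ≤ 1 := Real.sqrt_le_one.2 hc1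
  have hsq := Real.sq_sqrt (show 0 ≤ c by linarith)
  have hmain2 : 4 * √c * (1 - √c) ≤ 4 * a * (1 - a) + 4 * b * (1 - b) := by
    nlinarith [sq_nonneg (1 - √c)]
  have ht2 : t ^ 2 ≤ 1 := by
    rw [ht, sq_abs]
    nlinarith [hp.1, hp.2]
  have ht0 := sq_nonneg t
  refine Stmt8Aux.F_sub (s := 4 * t ^ 2 * √c * (1 - √c)) (u := 4 * t ^ 2 * a * (1 - a))
    (v := 4 * t ^ 2 * b * (1 - b)) ?_ ?_ ?_ ?_ ?_ |>.trans_eq' ?_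
  · exact mul_nonneg (by positivity) (by linarith)
  · exact mul_nonneg (by positivity) (by linarith)
  · exact mul_nonneg (by positivity) (by linarith)
  · have h7 : 4 * √c * (1 - √c) ≤ 1 := by nlinarith [sq_nonneg (2 * √c - 1)]
    have h8 : 0 ≤ 4 * √c * (1 - √c) := mul_nonneg (by positivity) (by linarith)
    calc 4 * t ^ 2 * √c * (1 - √c) = t ^ 2 * (4 * √c * (1 - √c)) := by ring
      _ ≤ 1 := mul_le_one₀ ht2 h8 h7
  · have := mul_le_mul_of_nonneg_left hmain2 ht0
    linarith
  · rfl
end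

section
/- Let a, b, c be nonzero vectors in ℝ³, and let α, β, γ ∈ [0, π] be the angles between a and b, between b and c, and between c and a, respectively. Then sin α + sin β ≥ sin γ. -/
open InnerProductGeometry

/-- For nonzero vectors `a, b, c` in `ℝ³` with pairwise angles `α, β, γ`
(between `a,b`, `b,c`, `c,a` respectively), `sin α + sin β ≥ sin γ`. -/
theorem stmt9 (a b c : EuclideanSpace ℝ (Fin 3))
    (ha : a ≠ 0) (hb : b ≠ 0) (hc : c ≠ 0) :
    Real.sin (angle c a) ≤ Real.sin (angle a b) + Real.sin (angle b c) := by
  have h1 := angle_le_angle_add_angle a b c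
  have h2 := angle_le_angle_add_angle a c b
  have h3 := angle_le_angle_add_angle b a c
  have h4 := angle_le_angle_add_angle a (-b) c
  rw [angle_neg_right, angle_neg_left] at h4
  rw [angle_comm c b] at h2
  rw [angle_comm b a] at h3
  rw [angle_comm c a]
  have z0 := angle_nonneg a c
  have z1 := angle_le_pi a c
  have x0 := angle_nonneg a b
  have y0 := angle_nonneg b c
  generalize angle a b = x at *
  generalize angle b c = y at *
  generalize angle a c = z at *
  have e1 : Real.sin x + Real.sin y
      = 2 * Real.sin ((x + y) / 2) * Real.cos ((x - y) / 2) := by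
    have hx : x = (x + y) / 2 + (x - y) / 2 := by ring
    have hy : y = (x + y) / 2 - (x - y) / 2 := by ring
    have := Real.sin_add ((x + y) / 2) ((x - y) / 2)
    have := Real.sin_sub ((x + y) / 2) ((x - y) / 2)
    rw [← hx] at *
    rw [← hy] at *
    linarith
  have e2 : Real.sin z = 2 * Real.sin (z / 2) * Real.cos (z / 2) := by
    rw [← Real.sin_two_mul]; congr 1; ring
  have hs : Real.sin (z / 2) ≤ Real.sin ((x + y) / 2) := by
    have := Real.sin_sub_sin ((x + y) / 2) (z / 2)
    have p := Real.sin_nonneg_of_nonneg_of_le_pi (x := ((x + y) / 2 - z / 2) / 2)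
      (by linarith) (by linarith)
    have q := Real.cos_nonneg_of_neg_pi_div_two_le_of_le (x := ((x + y) / 2 + z / 2) / 2)
      (by linarith) (by linarith)
    have := mul_nonneg p q
    linarith
  have hcs : Real.cos (z / 2) ≤ Real.cos ((x - y) / 2) := by
    rw [← Real.cos_abs ((x - y) / 2)]
    apply Real.cos_le_cos_of_nonneg_of_le_pi (abs_nonneg _) (by linarith)
    rw [abs_le]; constructor <;> linarith
  have hs0 := Real.sin_nonneg_of_nonneg_of_le_pi (x := z / 2) (by linarith) (by linarith)
  have hc0 := Real.cos_nonneg_of_neg_pi_div_two_le_of_le (x := z / 2)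
    (by linarith) (by linarith)
  have := mul_le_mul hs hcs hc0 (hs0.trans hs)
  rw [e1, e2]
  linarith
end

section
/- Let x, z, r be unit vectors in ℂ², and set a = |⟨r, x⟩|², b = |⟨r, z⟩|², c = |⟨x, z⟩|². Then √(a·(1−a)) + √(b·(1−b)) ≥ √(c·(1−c)). -/
open scoped InnerProductSpace

lemma aux_real (a b c : ℝ) (ha0 : 0 ≤ a) (ha1 : a ≤ 1) (hb0 : 0 ≤ b) (hb1 : b ≤ 1)
    (h : |c - a * b - (1 - a) * (1 - b)|
      ≤ 2 * (Real.sqrt (a * (1 - a)) * Real.sqrt (b * (1 - b)))) :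
    Real.sqrt (c * (1 - c)) ≤ Real.sqrt (a * (1 - a)) + Real.sqrt (b * (1 - b)) := by
  have hS := Real.sq_sqrt (mul_nonneg ha0 (sub_nonneg.2 ha1))
  have hT := Real.sq_sqrt (mul_nonneg hb0 (sub_nonneg.2 hb1))
  have hS0 := Real.sqrt_nonneg (a * (1 - a))
  have hT0 := Real.sqrt_nonneg (b * (1 - b))
  set S := Real.sqrt (a * (1 - a))
  set T := Real.sqrt (b * (1 - b))
  apply Real.sqrt_le_iff.2 ⟨by positivity, ?_⟩
  obtain ⟨A, hA⟩ : ∃ A, A = 2 * a - 1 := ⟨_, rfl⟩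
  obtain ⟨B, hB⟩ : ∃ B, B = 2 * b - 1 := ⟨_, rfl⟩
  obtain ⟨C, hC⟩ : ∃ C, C = 2 * c - 1 := ⟨_, rfl⟩
  obtain ⟨p, hp⟩ : ∃ p, p = 4 * (S * T) := ⟨_, rfl⟩
  have hp0 : 0 ≤ p := by rw [hp]; positivity
  have hp2 : p ^ 2 = (1 - A ^ 2) * (1 - B ^ 2) := by
    rw [hp, mul_pow, mul_pow, hS, hT, hA, hB]; ring
  have hCAB : |A * B - C| ≤ p := by
    rw [abs_le] at h ⊢
    subst hA hB hC hp
    constructor <;> linarith [h.1, h.2]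
  have hAB : |A * B| ≤ 1 := by
    rw [abs_mul]
    have h1 : |A| ≤ 1 := abs_le.2 ⟨by linarith, by linarith⟩
    have h2 : |B| ≤ 1 := abs_le.2 ⟨by linarith, by linarith⟩
    exact mul_le_one₀ h1 (abs_nonneg _) h2
  have h3 : |A * B| ≤ |C| + p := by
    have := abs_sub_abs_le_abs_sub (A * B) C
    linarith
  have key : 0 ≤ C ^ 2 + 2 * p + p ^ 2 - (A * B) ^ 2 := by
    rw [← sq_abs C, ← sq_abs (A * B)]
    have hc := abs_nonneg C
    have hab := abs_nonneg (A * B)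
    rcases le_total |A * B| p with h4 | h4
    · nlinarith
    · nlinarith [mul_nonneg hp0 (sub_nonneg.2 hAB)]
  have e : (S + T) ^ 2 = a * (1 - a) + b * (1 - b) + p / 2 := by
    rw [← hS, ← hT, hp]; ring
  rw [e]
  subst hA hB hC
  nlinarith

theorem stmt13 (x z r : EuclideanSpace ℂ (Fin 2))
    (hx : ‖x‖ = 1) (hz : ‖z‖ = 1) (hr : ‖r‖ = 1) :
    Real.sqrt (‖⟪x, z⟫_ℂ‖ ^ 2 * (1 - ‖⟪x, z⟫_ℂ‖ ^ 2))
      ≤ Real.sqrt (‖⟪r, x⟫_ℂ‖ ^ 2 * (1 - ‖⟪r, x⟫_ℂ‖ ^ 2))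
        + Real.sqrt (‖⟪r, z⟫_ℂ‖ ^ 2 * (1 - ‖⟪r, z⟫_ℂ‖ ^ 2)) := by
  have lag : ∀ y : EuclideanSpace ℂ (Fin 2), ‖y‖ = 1 →
      ‖r 0 * y 1 - r 1 * y 0‖ ^ 2 = 1 - ‖⟪r, y⟫_ℂ‖ ^ 2 := by
    intro y hy
    have h1 : ‖r‖ ^ 2 * ‖y‖ ^ 2 = 1 := by rw [hr, hy]; norm_num
    rw [EuclideanSpace.norm_sq_eq, EuclideanSpace.norm_sq_eq] at h1
    rw [← h1]
    simp only [PiLp.inner_apply, Fin.sum_univ_two, RCLike.inner_apply, Complex.sq_norm,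
      Complex.normSq_apply, Complex.add_re, Complex.add_im, Complex.sub_re, Complex.sub_im,
      Complex.mul_re, Complex.mul_im, Complex.conj_re, Complex.conj_im]
    ring
  have hrr : (starRingEnd ℂ) (r 0) * r 0 + (starRingEnd ℂ) (r 1) * r 1 = 1 := by
    have h1 : ⟪r, r⟫_ℂ = 1 := by rw [inner_self_eq_norm_sq_to_K, hr]; norm_num
    rw [PiLp.inner_apply, Fin.sum_univ_two] at h1
    simp only [RCLike.inner_apply] at h1
    rw [← h1]; ring
  have hdec : ⟪x, z⟫_ℂ = (starRingEnd ℂ) ⟪r, x⟫_ℂ * ⟪r, z⟫_ℂ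
      + (starRingEnd ℂ) (r 0 * x 1 - r 1 * x 0) * (r 0 * z 1 - r 1 * z 0) := by
    rw [← mul_one ⟪x, z⟫_ℂ, ← hrr]
    simp only [PiLp.inner_apply, Fin.sum_univ_two, RCLike.inner_apply, map_add, map_sub, map_mul,
      Complex.conj_conj]
    ring
  have lx := lag x hx
  have lz := lag z hz
  generalize r 0 * x 1 - r 1 * x 0 = d at *
  generalize r 0 * z 1 - r 1 * z 0 = f at *
  generalize ⟪r, x⟫_ℂ = g at *
  generalize ⟪r, z⟫_ℂ = k at *
  rw [hdec]
  apply aux_real _ _ _ (by positivity) (by linarith [sq_nonneg ‖d‖]) (by positivity)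
    (by linarith [sq_nonneg ‖f‖])
  rw [← lx, ← lz, ← mul_pow ‖g‖ ‖d‖, ← mul_pow ‖k‖ ‖f‖, Real.sqrt_sq (by positivity), Real.sqrt_sq (by positivity)]
  have e : ‖(starRingEnd ℂ) g * k + (starRingEnd ℂ) d * f‖ ^ 2 - ‖g‖ ^ 2 * ‖k‖ ^ 2
      - ‖d‖ ^ 2 * ‖f‖ ^ 2
      = 2 * (((starRingEnd ℂ) g * k) * (starRingEnd ℂ) ((starRingEnd ℂ) d * f)).re := by
    rw [Complex.sq_norm, Complex.normSq_add]
    simp only [Complex.normSq_mul, Complex.normSq_conj, Complex.sq_norm]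
    ring
  rw [e, abs_mul, abs_two]
  have := Complex.abs_re_le_norm
    (((starRingEnd ℂ) g * k) * (starRingEnd ℂ) ((starRingEnd ℂ) d * f))
  simp only [norm_mul, RCLike.norm_conj] at this
  linarith
end

section
/- Let ρ be a 2×2 complex density matrix with purity P = Tr(ρ²), let {x, x_⊥} and {z, z_⊥} be two orthonormal bases of ℂ², and set c = |⟨x, z⟩|². Then 2|⟨x, ρ x_⊥⟩| + 2|⟨z, ρ z_⊥⟩| ≥ 2·√((2P − 1)·c·(1 − c)). (This is the qubit quantum uncertainty relation for the l₁-norm of coherence: C_{l₁}^X(ρ) + C_{l₁}^Z(ρ) ≥ 2√((2P−1)c(1−c)).) -/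
open Matrix ComplexOrder

lemma core_real (c t B w K : ℝ) (hc0 : 0 ≤ c) (hc1 : c ≤ 1) (hB : 0 ≤ B) (hw : 0 ≤ w)
    (hK : K = t ^ 2 + 4 * B ^ 2)
    (h : Real.sqrt (c * (1 - c)) * |t| ≤ w + |2 * c - 1| * B) :
    Real.sqrt (K * c * (1 - c)) ≤ B + w := by
  apply Real.sqrt_le_iff.2 ⟨by positivity, ?_⟩
  have hq : 0 ≤ c * (1 - c) := mul_nonneg hc0 (by linarith)
  have h2 := pow_le_pow_left₀ (by positivity) h 2
  rw [mul_pow, Real.sq_sqrt hq, sq_abs] at h2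
  have hk1 : |2 * c - 1| ≤ 1 := abs_le.2 ⟨by linarith, by linarith⟩
  have hk2 : |2 * c - 1| ^ 2 = (2 * c - 1) ^ 2 := sq_abs _
  have h3 : |2 * c - 1| * (w * B) ≤ 1 * (w * B) :=
    mul_le_mul_of_nonneg_right hk1 (by positivity)
  have h4 : (w + |2 * c - 1| * B) ^ 2 = w ^ 2 + 2 * (|2 * c - 1| * (w * B))
      + (2 * c - 1) ^ 2 * B ^ 2 := by rw [← hk2]; ring
  rw [h4] at h2
  subst hK
  nlinarith

lemma core_cplx (a d : ℝ) (b α β γ δ : ℂ)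
    (h1 : star α * α + star β * β = 1) (h2 : star γ * γ + star δ * δ = 1)
    (h3 : star α * γ + star β * δ = 0) :
    Real.sqrt (‖α‖ ^ 2 * (1 - ‖α‖ ^ 2)) * |a - d| ≤
      ‖star α * γ * a + star α * δ * b + star β * γ * star b + star β * δ * d‖
       + |2 * ‖α‖ ^ 2 - 1| * ‖b‖ := by
  set μ := α * δ - β * γ with hμ
  have hγ : γ = - star β * μ := by
    rw [hμ]; linear_combination α * h3 - γ * h1
  have hδ : δ = star α * μ := by
    rw [hμ]; linear_combination β * h3 - δ * h1
  have hn : ∀ v : ℂ, star v * v = ((‖v‖ ^ 2 : ℝ) : ℂ) := by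
    intro v
    have := Complex.conj_mul' v
    simpa using this
  have hαβ : ‖α‖ ^ 2 + ‖β‖ ^ 2 = 1 := by
    rw [hn, hn] at h1; exact_mod_cast h1
  have hγδ : ‖γ‖ ^ 2 + ‖δ‖ ^ 2 = 1 := by
    rw [hn, hn] at h2; exact_mod_cast h2
  have hμn : ‖μ‖ = 1 := by
    rw [hγ, hδ] at hγδ
    simp only [norm_mul, norm_neg, norm_star, mul_pow] at hγδ
    have : ‖μ‖ ^ 2 = 1 := by nlinarith
    nlinarith [norm_nonneg μ]
  have hw : star α * γ * a + star α * δ * b + star β * γ * star b + star β * δ * d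
      = (star α * star β * (d - a) + star α ^ 2 * b - star β ^ 2 * star b) * μ := by
    rw [hγ, hδ]; ring
  rw [hw, norm_mul, hμn, mul_one]
  have hb : 1 - ‖α‖ ^ 2 = ‖β‖ ^ 2 := by linarith
  have hsq : Real.sqrt (‖α‖ ^ 2 * (1 - ‖α‖ ^ 2)) = ‖α‖ * ‖β‖ := by
    rw [hb, ← mul_pow]; exact Real.sqrt_sq (by positivity)
  rw [hsq]
  set w := star α * star β * (d - a) + star α ^ 2 * b - star β ^ 2 * star b with hwdef
  rcases (by positivity : 0 ≤ ‖α‖ * ‖β‖).eq_or_lt with h0 | hpos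
  · rw [← h0, zero_mul]; positivity
  have hre : (w * (α * β)).re = (‖α‖ * ‖β‖) ^ 2 * (d - a)
      + (2 * ‖α‖ ^ 2 - 1) * (b * star α * β).re := by
    have e : w * (α * β) = (star α * α) * (star β * β) * (d - a)
      + (star α * α) * (b * star α * β) - (star β * β) * star (b * star α * β) := by
      rw [hwdef]; simp only [star_mul', star_star]; ring
    rw [e, hn, hn, ← Complex.ofReal_sub, ← Complex.ofReal_mul, ← Complex.ofReal_mul]
    rw [Complex.sub_re, Complex.add_re, Complex.re_ofReal_mul, Complex.re_ofReal_mul,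
      Complex.ofReal_re]
    have : (star (b * star α * β)).re = (b * star α * β).re := Complex.conj_re _
    rw [this, ← hb]
    rw [mul_pow, ← hb]; ring
  have hA : |(w * (α * β)).re| ≤ ‖w‖ * (‖α‖ * ‖β‖) := by
    simpa using Complex.abs_re_le_norm (w * (α * β))
  have hBb : |(b * star α * β).re| ≤ ‖b‖ * (‖α‖ * ‖β‖) := by
    have := Complex.abs_re_le_norm (b * star α * β)
    rwa [norm_mul, norm_mul, norm_star, mul_assoc ‖b‖] at this
  have hfin : (‖α‖ * ‖β‖) ^ 2 * |a - d| ≤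
      ‖w‖ * (‖α‖ * ‖β‖) + |2 * ‖α‖ ^ 2 - 1| * (‖b‖ * (‖α‖ * ‖β‖)) := by
    have e : (‖α‖ * ‖β‖) ^ 2 * |a - d| = |(w * (α * β)).re
        - (2 * ‖α‖ ^ 2 - 1) * (b * star α * β).re| := by
      rw [hre, add_sub_cancel_right, abs_mul, abs_of_nonneg (sq_nonneg (‖α‖ * ‖β‖)), abs_sub_comm]
    rw [e]
    refine (abs_sub _ _).trans (add_le_add hA ?_)
    rw [abs_mul]
    exact mul_le_mul_of_nonneg_left hBb (abs_nonneg _)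
  refine le_of_mul_le_mul_right ?_ hpos
  linarith

/-- Qubit quantum uncertainty relation for the `l₁`-norm of coherence: for a qubit
density matrix `ρ` of purity `P` and two orthonormal bases `{x, x⊥}`, `{z, z⊥}` of `ℂ²`
with `c = |⟨x,z⟩|²`, one has
`2|⟨x, ρ x⊥⟩| + 2|⟨z, ρ z⊥⟩| ≥ 2√((2P-1)c(1-c))`. -/
theorem stmt14 (ρ : Matrix (Fin 2) (Fin 2) ℂ) (hρ : ρ.PosSemidef) (htr : ρ.trace = 1)
    (P : ℝ) (hP : (ρ * ρ).trace = (P : ℂ))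
    (x xp z zp : Fin 2 → ℂ)
    (hx : star x ⬝ᵥ x = 1) (hxp : star xp ⬝ᵥ xp = 1) (hxxp : star x ⬝ᵥ xp = 0)
    (hz : star z ⬝ᵥ z = 1) (hzp : star zp ⬝ᵥ zp = 1) (hzzp : star z ⬝ᵥ zp = 0)
    (c : ℝ) (hc : c = ‖star x ⬝ᵥ z‖ ^ 2) :
    2 * Real.sqrt ((2 * P - 1) * c * (1 - c))
      ≤ 2 * ‖star x ⬝ᵥ (ρ *ᵥ xp)‖ + 2 * ‖star z ⬝ᵥ (ρ *ᵥ zp)‖ := by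
  set U : Matrix (Fin 2) (Fin 2) ℂ := !![x 0, xp 0; x 1, xp 1] with hU
  have hxpx : star xp ⬝ᵥ x = 0 := by
    have := congrArg star hxxp
    simp only [dotProduct, Fin.sum_univ_two, Pi.star_apply, star_add, star_mul', star_star,
      star_zero] at this ⊢
    linear_combination this
  have hUU : Uᴴ * U = 1 := by
    simp only [dotProduct, Fin.sum_univ_two, Pi.star_apply] at hx hxp hxxp hxpx
    ext i j
    fin_cases i <;> fin_cases j <;>
      simp [hU, Matrix.mul_apply, Fin.sum_univ_two] <;> assumption
  have hUU' : U * Uᴴ = 1 := mul_eq_one_comm.1 hUU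
  set A := Uᴴ * ρ * U with hA
  have hAh : Aᴴ = A := by
    rw [hA]; simp only [conjTranspose_mul, conjTranspose_conjTranspose, hρ.1.eq, mul_assoc]
  have hρA : ρ = U * A * Uᴴ := by
    rw [hA]
    calc ρ = (U * Uᴴ) * ρ * (U * Uᴴ) := by rw [hUU']; simp
      _ = _ := by simp only [mul_assoc]
  have hAtr : A.trace = 1 := by
    rw [hA, Matrix.trace_mul_comm, ← mul_assoc, hUU', one_mul, htr]
  have hAP : (A * A).trace = (P : ℂ) := by
    have : A * A = Uᴴ * (ρ * ρ * U) := by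
      rw [hA]
      calc Uᴴ * ρ * U * (Uᴴ * ρ * U) = Uᴴ * ρ * (U * Uᴴ) * ρ * U := by simp only [mul_assoc]
        _ = _ := by rw [hUU']; simp only [mul_assoc, one_mul, mul_one]
    rw [this, Matrix.trace_mul_comm, mul_assoc, hUU', mul_one, hP]
  have hA01 : star x ⬝ᵥ (ρ *ᵥ xp) = A 0 1 := by
    simp [hA, hU, Matrix.mul_apply, dotProduct, mulVec, Fin.sum_univ_two]; ring
  have key : ∀ u v : Fin 2 → ℂ, ∀ M : Matrix (Fin 2) (Fin 2) ℂ,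
      star u ⬝ᵥ ((U * M * Uᴴ) *ᵥ v) = star (Uᴴ *ᵥ u) ⬝ᵥ (M *ᵥ (Uᴴ *ᵥ v)) := by
    intro u v M
    rw [star_mulVec, conjTranspose_conjTranspose, ← dotProduct_mulVec]
    simp only [mulVec_mulVec, mul_assoc]
  have key1 : ∀ u v : Fin 2 → ℂ,
      star u ⬝ᵥ v = star (Uᴴ *ᵥ u) ⬝ᵥ (Uᴴ *ᵥ v) := by
    intro u v
    have := key u v 1
    rwa [mul_one, hUU', one_mulVec, one_mulVec] at this
  have hα : star x ⬝ᵥ z = (Uᴴ *ᵥ z) 0 := by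
    simp [hU, dotProduct, mulVec, Fin.sum_univ_two]
  have hW : star z ⬝ᵥ (ρ *ᵥ zp) = star (Uᴴ *ᵥ z) ⬝ᵥ (A *ᵥ (Uᴴ *ᵥ zp)) := by
    rw [← key, ← hρA]
  rw [key1] at hz hzp hzzp
  rw [hA01, hW]
  rw [hα] at hc
  generalize Uᴴ *ᵥ z = p at *
  generalize Uᴴ *ᵥ zp = r at *
  clear_value A
  simp only [dotProduct, Fin.sum_univ_two, Pi.star_apply, mulVec] at hz hzp hzzp ⊢
  have e00 : star (A 0 0) = A 0 0 := congrFun (congrFun hAh 0) 0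
  have e11 : star (A 1 1) = A 1 1 := congrFun (congrFun hAh 1) 1
  have e10 : A 1 0 = star (A 0 1) := (congrFun (congrFun hAh 1) 0).symm
  obtain ⟨a, ha⟩ := Complex.conj_eq_iff_real.1 e00
  obtain ⟨d, hd⟩ := Complex.conj_eq_iff_real.1 e11
  have hcc := core_cplx a d (A 0 1) (p 0) (p 1) (r 0) (r 1) hz hzp hzzp
  have hn : ∀ v : ℂ, star v * v = ((‖v‖ ^ 2 : ℝ) : ℂ) := by
    intro v
    have := Complex.conj_mul' v
    simpa using this
  have hp : ‖p 0‖ ^ 2 + ‖p 1‖ ^ 2 = 1 := by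
    rw [hn, hn] at hz; exact_mod_cast hz
  have had : a + d = 1 := by
    rw [Matrix.trace_fin_two, ha, hd] at hAtr; exact_mod_cast hAtr
  have hPP : a ^ 2 + d ^ 2 + 2 * ‖A 0 1‖ ^ 2 = P := by
    have : (A * A).trace = ((a ^ 2 + d ^ 2 + 2 * ‖A 0 1‖ ^ 2 : ℝ) : ℂ) := by
      have h := hn (A 0 1)
      rw [Matrix.trace_fin_two, Matrix.mul_apply, Matrix.mul_apply]
      simp only [Fin.sum_univ_two]
      rw [e10, ha, hd]
      push_cast at h ⊢
      linear_combination 2 * h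
    rw [this] at hAP; exact_mod_cast hAP
  rw [← hc] at hcc
  have := core_real c (a - d) ‖A 0 1‖ _ (2 * P - 1) (by rw [hc]; positivity)
    (by rw [hc]; nlinarith [sq_nonneg ‖p 1‖]) (norm_nonneg _) (norm_nonneg _)
    (by rw [← hPP]; have : d = 1 - a := by linarith
        subst this; ring) hcc
  have ew : star (p 0) * (A 0 0 * r 0 + A 0 1 * r 1) + star (p 1) * (A 1 0 * r 0 + A 1 1 * r 1)
    = star (p 0) * r 0 * a + star (p 0) * r 1 * A 0 1 + star (p 1) * r 0 * star (A 0 1)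
      + star (p 1) * r 1 * d := by
    rw [e10, ha, hd]; ring
  rw [ew]
  linarith
end

section
/- For every c ∈ [1/2, 1] and every P ∈ [1/2, 1], there exist a 2×2 complex density matrix ρ with Tr(ρ²) = P and orthonormal bases {x, x_⊥}, {z, z_⊥} of ℂ² with |⟨x, z⟩|² = c such that 2|⟨x, ρ x_⊥⟩| + 2|⟨z, ρ z_⊥⟩| = 2·√((2P − 1)·c·(1 − c)). (The lower bound in the l₁-norm quantum uncertainty relation is saturated.) -/
open Matrix ComplexOrder

/-- Tightness of the `l₁`-norm quantum uncertainty relation: for every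
`c ∈ [1/2, 1]` and `P ∈ [1/2, 1]` there are a qubit density matrix `ρ` of purity `P`
and orthonormal bases `{x, x⊥}`, `{z, z⊥}` of `ℂ²` with `|⟨x,z⟩|² = c` saturating
`2|⟨x, ρ x⊥⟩| + 2|⟨z, ρ z⊥⟩| = 2√((2P-1)c(1-c))`. -/
theorem stmt15 (c P : ℝ) (hc : c ∈ Set.Icc (1/2 : ℝ) 1) (hP : P ∈ Set.Icc (1/2 : ℝ) 1) :
    ∃ (ρ : Matrix (Fin 2) (Fin 2) ℂ) (x xp z zp : Fin 2 → ℂ),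
      ρ.PosSemidef ∧ ρ.trace = 1 ∧ (ρ * ρ).trace = (P : ℂ) ∧
      star x ⬝ᵥ x = 1 ∧ star xp ⬝ᵥ xp = 1 ∧ star x ⬝ᵥ xp = 0 ∧
      star z ⬝ᵥ z = 1 ∧ star zp ⬝ᵥ zp = 1 ∧ star z ⬝ᵥ zp = 0 ∧
      ‖star x ⬝ᵥ z‖ ^ 2 = c ∧
      2 * ‖star x ⬝ᵥ (ρ *ᵥ xp)‖ + 2 * ‖star z ⬝ᵥ (ρ *ᵥ zp)‖
        = 2 * Real.sqrt ((2 * P - 1) * c * (1 - c)) := by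
  obtain ⟨hc1, hc2⟩ := hc
  obtain ⟨hP1, hP2⟩ := hP
  obtain ⟨a, ha⟩ : ∃ a, a = Real.sqrt c := ⟨_, rfl⟩
  obtain ⟨b, hb⟩ : ∃ b, b = Real.sqrt (1 - c) := ⟨_, rfl⟩
  obtain ⟨r, hr⟩ : ∃ r, r = Real.sqrt (2 * P - 1) := ⟨_, rfl⟩
  have ha0 : 0 ≤ a := ha ▸ Real.sqrt_nonneg _
  have hb0 : 0 ≤ b := hb ▸ Real.sqrt_nonneg _
  have hr0 : 0 ≤ r := hr ▸ Real.sqrt_nonneg _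
  have ha2 : a ^ 2 = c := by rw [ha]; exact Real.sq_sqrt (by linarith)
  have hb2 : b ^ 2 = 1 - c := by rw [hb]; exact Real.sq_sqrt (by linarith)
  have hr2 : r ^ 2 = 2 * P - 1 := by rw [hr]; exact Real.sq_sqrt (by linarith)
  have hr1 : r ≤ 1 := by nlinarith
  have hS : Real.sqrt ((2 * P - 1) * c * (1 - c)) = r * a * b := by
    rw [← hr2, ← hb2, ← ha2, ← mul_pow, ← mul_pow]
    exact Real.sqrt_sq (by positivity)
  have hab : (a : ℂ) * a + b * b = 1 := by
    have : a * a + b * b = 1 := by nlinarith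
    exact_mod_cast this
  have hrr : (r : ℂ) * r = 2 * P - 1 := by
    have : r * r = 2 * P - 1 := by nlinarith
    exact_mod_cast this
  refine ⟨Matrix.diagonal ![(((1 + r) / 2 : ℝ) : ℂ), (((1 - r) / 2 : ℝ) : ℂ)],
    ![1, 0], ![0, 1], ![(a : ℂ), (b : ℂ)], ![(b : ℂ), -(a : ℂ)], ?_, ?_, ?_, ?_, ?_, ?_, ?_, ?_, ?_, ?_, ?_⟩
  · rw [Matrix.posSemidef_diagonal_iff]
    intro i
    fin_cases i
    · exact Complex.zero_le_real.2 (by linarith)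
    · exact Complex.zero_le_real.2 (by linarith)
  · simp [Matrix.trace, Fin.sum_univ_two]
    ring
  · simp [Matrix.trace, Fin.sum_univ_two]
    linear_combination (1 / 2 : ℂ) * hrr
  · simp [dotProduct, Fin.sum_univ_two]
  · simp [dotProduct, Fin.sum_univ_two]
  · simp [dotProduct, Fin.sum_univ_two]
  · simp [dotProduct, Fin.sum_univ_two]
    linear_combination hab
  · simp [dotProduct, Fin.sum_univ_two]
    linear_combination hab
  · simp [dotProduct, Fin.sum_univ_two]
    ring
  · simp [dotProduct, Fin.sum_univ_two, ha2]
  · rw [hS]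
    have h1 : star ![(1 : ℂ), 0] ⬝ᵥ (Matrix.diagonal ![(((1 + r) / 2 : ℝ) : ℂ), (((1 - r) / 2 : ℝ) : ℂ)] *ᵥ ![0, 1]) = 0 := by
      simp [dotProduct, Fin.sum_univ_two, Matrix.mulVec_diagonal]
    have h2 : star ![(a : ℂ), (b : ℂ)] ⬝ᵥ (Matrix.diagonal ![(((1 + r) / 2 : ℝ) : ℂ), (((1 - r) / 2 : ℝ) : ℂ)] *ᵥ ![(b : ℂ), -(a : ℂ)]) = ((r * a * b : ℝ) : ℂ) := by
      simp [dotProduct, Fin.sum_univ_two, Matrix.mulVec_diagonal]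
      ring
    rw [h1, h2, Complex.norm_real, Real.norm_of_nonneg (by positivity)]
    simp
end
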